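/- arXiv:2404.02246 — 2 statements merged into one kernel-verified Lean document; each statement's English description precedes it below -/
import Mathlib

section
/- Let W be a d×d matrix weight on ℝ^n, let 1 < t < ∞ and write t' := t/(t−1). Then there exist constants c₁, c₂ > 0 depending only on d, t such that max([W]_{A_t}, [W]_{RH_{t,∞}})^{t'/t} ≤ c₁·[W^{t'/t}]_{A_{t',∞}} and [W^{t'/t}]_{A_{t',∞}} ≤ c₂·([W]_{A_t}·[W]_{RH_{t,∞}})^{t'/t}. In particular, [W]_{A_t} < ∞ and [W]_{RH_{t,∞}} < ∞ if and only if [W^{t'/t}]_{A_{t',∞}} < ∞. -/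
open MeasureTheory ENNReal
open scoped ComplexOrder

noncomputable section

/-- The power `A^a` of a matrix, defined via the continuous functional calculus
(for positive definite Hermitian matrices this diagonalizes `A` and raises the
eigenvalues to the `a`-th power). -/
def matRpow {d : ℕ} (A : Matrix (Fin d) (Fin d) ℂ) (a : ℝ) : Matrix (Fin d) (Fin d) ℂ :=
  cfc (fun x : ℝ => x ^ a) A

/-- The spectral norm (largest singular value) of a matrix, i.e. its norm as an operator
on the Euclidean space `ℂ^d`. -/
def specNorm {d : ℕ} (A : Matrix (Fin d) (Fin d) ℂ) : ℝ :=
  ‖Matrix.toEuclideanCLM (𝕜 := ℂ) A‖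

/-- Hölder conjugate exponent. -/
def conjExp (p : ℝ) : ℝ := p / (p - 1)

/-- The Lebesgue average `⨍_Q f dμ` of an `ℝ≥0∞`-valued function. -/
def lavg {α : Type*} [MeasurableSpace α] (μ : Measure α) (Q : Set α) (f : α → ℝ≥0∞) : ℝ≥0∞ :=
  (μ Q)⁻¹ * ∫⁻ x in Q, f x ∂μ

/-- The two-exponent matrix Muckenhoupt characteristic `[W]_{A_{p,q}}`, with the supremum
taken over a family `S` of sets. -/
def matApq {α : Type*} [MeasurableSpace α] {d : ℕ} (μ : Measure α) (S : Set (Set α))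
    (W : α → Matrix (Fin d) (Fin d) ℂ) (p q : ℝ) : ℝ≥0∞ :=
  ⨆ Q ∈ S, lavg μ Q fun x =>
    (lavg μ Q fun y =>
        ENNReal.ofReal (specNorm (matRpow (W x) (1 / q) * matRpow (W y) (-(1 / q))))
          ^ conjExp p) ^ (q / conjExp p)

/-- The endpoint matrix Muckenhoupt characteristic `[W]_{A_{t,∞}}`, with the supremum
taken over a family `S` of sets. -/
def matAtInfty {α : Type*} [MeasurableSpace α] {d : ℕ} (μ : Measure α) (S : Set (Set α))
    (W : α → Matrix (Fin d) (Fin d) ℂ) (t : ℝ) : ℝ≥0∞ :=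
  ⨆ Q ∈ S, essSup (fun x =>
    lavg μ Q fun y =>
      ENNReal.ofReal (specNorm (matRpow (W x) (1 / t) * matRpow (W y) (-(1 / t)))) ^ t)
    (μ.restrict Q)

/-- The scalar reverse Hölder characteristic `[w]_{RH_s}`, with the supremum taken over a
family `S` of sets. -/
def scalRH {α : Type*} [MeasurableSpace α] (μ : Measure α) (S : Set (Set α))
    (w : α → ℝ) (s : ℝ) : ℝ≥0∞ :=
  ⨆ Q ∈ S, (lavg μ Q fun x => ENNReal.ofReal (w x) ^ s) ^ (1 / s) /
    lavg μ Q fun x => ENNReal.ofReal (w x)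

/-- The scalar reverse Hölder characteristic `[w]_{RH_∞}`, with the supremum taken over a
family `S` of sets. -/
def scalRHInfty {α : Type*} [MeasurableSpace α] (μ : Measure α) (S : Set (Set α))
    (w : α → ℝ) : ℝ≥0∞ :=
  ⨆ Q ∈ S, essSup (fun x => ENNReal.ofReal (w x)) (μ.restrict Q) /
    lavg μ Q fun x => ENNReal.ofReal (w x)

/-- The matrix reverse Hölder characteristic `[W]_{RH_{t,s}}`. -/
def matRH {α : Type*} [MeasurableSpace α] {d : ℕ} (μ : Measure α) (S : Set (Set α))
    (W : α → Matrix (Fin d) (Fin d) ℂ) (t s : ℝ) : ℝ≥0∞ :=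
  ⨆ (e : EuclideanSpace ℂ (Fin d)) (_ : e ≠ 0),
    scalRH μ S (fun x => ‖Matrix.toEuclideanCLM (𝕜 := ℂ) (matRpow (W x) (1 / t)) e‖ ^ t) s

/-- The matrix reverse Hölder characteristic `[W]_{RH_{t,∞}}`. -/
def matRHInfty {α : Type*} [MeasurableSpace α] {d : ℕ} (μ : Measure α) (S : Set (Set α))
    (W : α → Matrix (Fin d) (Fin d) ℂ) (t : ℝ) : ℝ≥0∞ :=
  ⨆ (e : EuclideanSpace ℂ (Fin d)) (_ : e ≠ 0),
    scalRHInfty μ S (fun x => ‖Matrix.toEuclideanCLM (𝕜 := ℂ) (matRpow (W x) (1 / t)) e‖ ^ t)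

/-- An axis-parallel cube in `ℝ^n` with corner `c` and positive side length `h`. -/
def cube {n : ℕ} (c : Fin n → ℝ) (h : ℝ) : Set (Fin n → ℝ) :=
  {x | ∀ i, x i ∈ Set.Ico (c i) (c i + h)}

/-- The family of all axis-parallel cubes in `ℝ^n`. -/
def cubes (n : ℕ) : Set (Set (Fin n → ℝ)) :=
  {Q | ∃ (c : Fin n → ℝ) (h : ℝ), 0 < h ∧ Q = cube c h}

/-- The family of all (left-closed right-open, nontrivial, bounded) intervals in `ℝ`,
i.e. the axis-parallel "cubes" of `ℝ^1`. -/
def intervalsR : Set (Set ℝ) := {I | ∃ a b : ℝ, a < b ∧ I = Set.Ico a b}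

/-- The family of all dyadic intervals `[m·2^k, (m+1)·2^k)`, `m, k ∈ ℤ`, in `ℝ`. -/
def dyadicsR : Set (Set ℝ) :=
  {I | ∃ m k : ℤ, I = Set.Ico ((m : ℝ) * 2 ^ k) (((m : ℝ) + 1) * 2 ^ k)}

/-- A `d×d` matrix weight: a locally integrable matrix-valued function whose values are
a.e. positive definite (Hermitian). -/
def IsMatrixWeight {α : Type*} [MeasurableSpace α] [TopologicalSpace α] {d : ℕ}
    (μ : Measure α) (W : α → Matrix (Fin d) (Fin d) ℂ) : Prop :=
  (∀ i j, LocallyIntegrable (fun x => W x i j) μ) ∧ ∀ᵐ x ∂μ, (W x).PosDef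

/-- Auerbach's lemma: a finite-dimensional normed space has a basis of vectors of norm at most one
whose coordinate functionals also have norm at most one. -/
theorem exists_auerbach_basis {𝕜 E ι : Type*} [RCLike 𝕜] [NormedAddCommGroup E]
    [NormedSpace 𝕜 E] [Fintype ι] (b₀ : Module.Basis ι 𝕜 E) :
    ∃ b : Module.Basis ι 𝕜 E, (∀ i, ‖b i‖ ≤ 1) ∧ ∀ i e, ‖b.coord i e‖ ≤ ‖e‖ := by
  classical
  have : FiniteDimensional 𝕜 E := b₀.finiteDimensional_of_finite
  have : ProperSpace E := FiniteDimensional.proper 𝕜 E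
  have hcont : Continuous fun v : ι → E => ‖b₀.det v‖ := by
    have h : Continuous fun v : ι → E => b₀.toMatrix v :=
      continuous_matrix fun i j =>
        (LinearMap.continuous_of_finiteDimensional (b₀.coord i)).comp (continuous_apply j)
    simpa only [Module.Basis.det_apply] using h.matrix_det.norm
  obtain ⟨v, hv, hmax⟩ := (isCompact_closedBall (0 : ι → E) 1).exists_isMaxOn
    ⟨0, by simp⟩ hcont.continuousOn
  have hball : ∀ w : ι → E, w ∈ Metric.closedBall 0 1 ↔ ∀ i, ‖w i‖ ≤ 1 := fun w => by
    rw [mem_closedBall_zero_iff, pi_norm_le_iff_of_nonneg zero_le_one]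
  have hpos : b₀.det v ≠ 0 := by
    have hw : (fun i => ((‖b₀ i‖⁻¹ : ℝ) : 𝕜) • b₀ i) ∈ Metric.closedBall (0 : ι → E) 1 := by
      rw [hball]
      intro i
      have := norm_ne_zero_iff.2 (b₀.ne_zero i)
      simp [norm_smul, this]
    have h1 := hmax hw
    have h2 : b₀.det (fun i => ((‖b₀ i‖⁻¹ : ℝ) : 𝕜) • b₀ i) ≠ 0 := by
      rw [AlternatingMap.map_smul_univ, b₀.det_self]
      simp [Finset.prod_eq_zero_iff, b₀.ne_zero]
    exact norm_pos_iff.1 ((norm_pos_iff.2 h2).trans_le h1)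
  obtain ⟨hli, hsp⟩ := b₀.is_basis_iff_det.2 (isUnit_iff_ne_zero.2 hpos)
  refine ⟨Module.Basis.mk hli hsp.ge, fun i => by simpa using (hball v).1 hv i, ?_⟩
  have key : ∀ i e, ‖e‖ ≤ 1 → ‖(Module.Basis.mk hli hsp.ge).coord i e‖ ≤ 1 := by
    intro i e he
    have h1 := DFunLike.congr_fun
      (Module.Basis.det_smul_mk_coord_eq_det_update hli hsp.ge i (e := b₀)) e
    have h2 : ‖b₀.det (Function.update v i e)‖ ≤ ‖b₀.det v‖ := hmax <| by
      rw [hball]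
      intro j
      rcases eq_or_ne j i with rfl | hj
      · simpa using he
      · simpa [hj] using (hball v).1 hv j
    simp only [LinearMap.smul_apply, smul_eq_mul, MultilinearMap.toLinearMap_apply,
      AlternatingMap.coe_multilinearMap] at h1
    rw [← h1, norm_mul] at h2
    exact le_of_mul_le_mul_left (by simpa using h2) (norm_pos_iff.2 hpos)
  intro i e
  rcases eq_or_ne e 0 with rfl | he
  · rw [map_zero, norm_zero, norm_zero]
  have he' : ‖e‖ ≠ 0 := norm_ne_zero_iff.2 he
  have := key i (((‖e‖⁻¹ : ℝ) : 𝕜) • e) (by simp [norm_smul, he'])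
  rw [map_smul, norm_smul] at this
  simp only [RCLike.norm_ofReal, abs_inv, abs_norm] at this
  rwa [inv_mul_le_iff₀ (by positivity), mul_one] at this

theorem exists_auerbach_basis_of_injective {𝕜 E F ι : Type*} [RCLike 𝕜] [AddCommGroup E]
    [Module 𝕜 E] [NormedAddCommGroup F] [NormedSpace 𝕜 F] [Fintype ι]
    (b₀ : Module.Basis ι 𝕜 E) (L : E →ₗ[𝕜] F) (hL : Function.Injective L) :
    ∃ b : Module.Basis ι 𝕜 E, (∀ i, ‖L (b i)‖ ≤ 1) ∧ ∀ i e, ‖b.coord i e‖ ≤ ‖L e‖ := by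
  obtain ⟨b, hb, hc⟩ := exists_auerbach_basis (b₀.map (LinearEquiv.ofInjective L hL))
  refine ⟨b.map (LinearEquiv.ofInjective L hL).symm, fun i => ?_, fun i e => ?_⟩
  · have := LinearEquiv.apply_symm_apply (LinearEquiv.ofInjective L hL) (b i)
    have h2 : L ((LinearEquiv.ofInjective L hL).symm (b i)) = (b i : F) := by
      rw [← this]; simp
    rw [Module.Basis.map_apply, h2]
    exact hb i
  · simpa using hc i (LinearEquiv.ofInjective L hL e)

theorem enorm_mul_comm_of_adjoint_eq {H : Type*} [NormedAddCommGroup H] [InnerProductSpace ℂ H]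
    [CompleteSpace H] {A B : H →L[ℂ] H} (hA : star A = A) (hB : star B = B) :
    ‖A * B‖ₑ = ‖B * A‖ₑ := by
  rw [← ofReal_norm, ← ofReal_norm, ← norm_star (A * B), star_mul, hA, hB]

/-- A basis adapted to the norm `e ↦ (∫ ‖V y e‖ ^ s) ^ (1 / s)`, with dual vectors controlled by the
mixed integral of `‖U z * V y‖`. -/
theorem exists_dual_basis_of_mixed_lintegral_ne_top {α H ι : Type*} [MeasurableSpace α]
    [NormedAddCommGroup H] [InnerProductSpace ℂ H] [CompleteSpace H] [Fintype ι]
    (b₀ : Module.Basis ι ℂ H) {ν : Measure α} [IsProbabilityMeasure ν]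
    {s t : ℝ} (hs : 1 < s) (ht : 0 < t) {U V : α → H →L[ℂ] H} (hVm : AEStronglyMeasurable V ν)
    (hU : ∀ᵐ x ∂ν, star (U x) = U x) (hV : ∀ᵐ x ∂ν, star (V x) = V x)
    (hUV : ∀ᵐ x ∂ν, U x * V x = 1)
    (hA : ∫⁻ z, (∫⁻ y, ‖U z * V y‖ₑ ^ s ∂ν) ^ (t / s) ∂ν ≠ ⊤) :
    ∃ (b : Module.Basis ι ℂ H) (q : ι → H), (∀ i e, b.coord i e = inner ℂ (q i) e) ∧
      (∀ i, ∫⁻ y, ‖V y (b i)‖ₑ ^ s ∂ν ≤ 1) ∧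
      ∀ i, ∫⁻ z, ‖U z (q i)‖ₑ ^ t ∂ν ≤ ∫⁻ z, (∫⁻ y, ‖U z * V y‖ₑ ^ s ∂ν) ^ (t / s) ∂ν := by
  have hs0 : 0 < s := by linarith
  have : FiniteDimensional ℂ H := b₀.finiteDimensional_of_finite
  have hVem : ∀ e, AEStronglyMeasurable (fun y => V y e) ν := fun e =>
    (ContinuousLinearMap.apply ℂ H e).continuous.comp_aestronglyMeasurable hVm
  have hsp0 : ENNReal.ofReal s ≠ 0 := by simpa using hs0
  have hsr : (ENNReal.ofReal s).toReal = s := ENNReal.toReal_ofReal hs0.le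
  have hcomm : ∀ z, star (U z) = U z → ∀ᵐ y ∂ν, ‖V y * U z‖ₑ = ‖U z * V y‖ₑ := by
    intro z hz
    filter_upwards [hV] with y hy using enorm_mul_comm_of_adjoint_eq hy hz
  have hbound : ∀ z, star (U z) = U z → ∀ f, ∫⁻ y, ‖V y (U z f)‖ₑ ^ s ∂ν ≤
      (∫⁻ y, ‖U z * V y‖ₑ ^ s ∂ν) * ‖f‖ₑ ^ s := by
    intro z hz f
    rw [← lintegral_mul_const' _ _ (by finiteness)]
    refine lintegral_mono_ae ?_
    filter_upwards [hcomm z hz] with y hy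
    rw [← hy, ← ENNReal.mul_rpow_of_nonneg _ _ hs0.le]
    gcongr
    exact (V y * U z).le_opENorm f
  obtain ⟨z₀, hz₀, hz₀U, hz₀V⟩ : ∃ z, (∫⁻ y, ‖U z * V y‖ₑ ^ s ∂ν ≠ ⊤) ∧ star (U z) = U z ∧
      U z * V z = 1 := by
    by_contra! hcon
    refine hA ?_
    have : ∀ᵐ z ∂ν, (∫⁻ y, ‖U z * V y‖ₑ ^ s ∂ν) ^ (t / s) = ⊤ := by
      filter_upwards [hU, hUV] with z h1 h2
      by_contra h3
      refine hcon z (fun h4 => h3 ?_) h1 h2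
      rw [h4, ENNReal.top_rpow_of_pos (by positivity)]
    rw [lintegral_congr_ae this]
    simp
  have hmem : ∀ e, MemLp (fun y => V y e) (ENNReal.ofReal s) ν := by
    intro e
    refine ⟨hVem e, ?_⟩
    rw [eLpNorm_lt_top_iff_lintegral_rpow_enorm_lt_top hsp0 ENNReal.ofReal_ne_top, hsr]
    have h := hbound z₀ hz₀U (V z₀ e)
    have h1 : U z₀ (V z₀ e) = e := by
      rw [← mul_apply_eq_comp, hz₀V, one_apply_eq_self]
    rw [h1] at h
    refine h.trans_lt (ENNReal.mul_lt_top hz₀.lt_top (by finiteness))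
  have : Fact (1 ≤ ENNReal.ofReal s) := ⟨by simpa using hs.le⟩
  let L : H →ₗ[ℂ] Lp H (ENNReal.ofReal s) ν :=
    { toFun := fun e => (hmem e).toLp _
      map_add' := fun e f => by
        rw [← MemLp.toLp_add]
        congr 1
        ext y
        simp
      map_smul' := fun c e => by
        rw [RingHom.id_apply, ← MemLp.toLp_const_smul]
        congr 1
        ext y
        simp }
  have hLnorm : ∀ e, ‖L e‖ₑ = (∫⁻ y, ‖V y e‖ₑ ^ s ∂ν) ^ (1 / s) := by
    intro e
    change ‖(hmem e).toLp _‖ₑ = _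
    rw [Lp.enorm_toLp, eLpNorm_eq_lintegral_rpow_enorm_toReal hsp0 ENNReal.ofReal_ne_top, hsr]
  have hinj : Function.Injective L := by
    rw [← LinearMap.ker_eq_bot, LinearMap.ker_eq_bot']
    intro e he
    have h1 : (fun y => V y e) =ᵐ[ν] 0 := (MemLp.toLp_eq_toLp_iff (hmem e) MemLp.zero).1
      (he.trans (MemLp.toLp_zero _).symm)
    have h2 : ∀ᵐ y ∂ν, star (V y) = V y ∧ V y e = 0 ∧ U y * V y = 1 := by
      filter_upwards [h1, hV, hUV] with y h2 h3 h4 using ⟨h3, h2, h4⟩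
    obtain ⟨y, -, h4, h5⟩ := h2.exists
    have h6 : (U y * V y) e = e := by rw [h5, one_apply_eq_self]
    rw [← h6, mul_apply_eq_comp, h4, map_zero]
  obtain ⟨b, hb, hbc⟩ := exists_auerbach_basis_of_injective b₀ L hinj
  let q : ι → H := fun i =>
    (InnerProductSpace.toDual ℂ H).symm (LinearMap.toContinuousLinearMap (b.coord i))
  have hq : ∀ i e, b.coord i e = inner ℂ (q i) e := fun i e => by
    simp [q]
  refine ⟨b, q, hq, fun i => ?_, fun i => ?_⟩
  · have h := hb i
    have h2 : ‖L (b i)‖ₑ ≤ 1 := by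
      rw [← ofReal_norm]
      exact ENNReal.ofReal_le_one.2 h
    rw [hLnorm] at h2
    have := ENNReal.rpow_le_rpow h2 hs0.le
    rwa [← ENNReal.rpow_mul, one_div, inv_mul_cancel₀ hs0.ne', ENNReal.rpow_one,
      ENNReal.one_rpow] at this
  · refine lintegral_mono_ae ?_
    filter_upwards [hU] with z hz
    have h1 : ‖U z (q i)‖ * ‖U z (q i)‖ ≤ ‖L (U z (U z (q i)))‖ := by
      refine le_trans (le_of_eq ?_) (hbc i _)
      rw [hq, ← ContinuousLinearMap.adjoint_inner_left, ← ContinuousLinearMap.star_eq_adjoint, hz,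
        inner_self_eq_norm_sq_to_K]
      simp [sq]
    have h2 : ‖U z (q i)‖ₑ * ‖U z (q i)‖ₑ ≤ ‖L (U z (U z (q i)))‖ₑ := by
      simp only [← ofReal_norm]
      rw [← ENNReal.ofReal_mul (norm_nonneg _)]
      exact ENNReal.ofReal_le_ofReal h1
    have h3 : ‖L (U z (U z (q i)))‖ₑ ≤
        (∫⁻ y, ‖U z * V y‖ₑ ^ s ∂ν) ^ (1 / s) * ‖U z (q i)‖ₑ := by
      rw [hLnorm]
      refine (ENNReal.rpow_le_rpow (hbound z hz _) (by positivity)).trans (le_of_eq ?_)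
      rw [ENNReal.mul_rpow_of_nonneg _ _ (by positivity), ← ENNReal.rpow_mul, mul_one_div_cancel
        hs0.ne', ENNReal.rpow_one]
    have h4 : ‖U z (q i)‖ₑ ≤ (∫⁻ y, ‖U z * V y‖ₑ ^ s ∂ν) ^ (1 / s) := by
      rcases eq_or_ne (U z (q i)) 0 with h0 | h0
      · simp [h0]
      · exact (ENNReal.mul_le_mul_iff_left (by simpa using h0) (by finiteness)).1 (h2.trans h3)
    calc ‖U z (q i)‖ₑ ^ t ≤ ((∫⁻ y, ‖U z * V y‖ₑ ^ s ∂ν) ^ (1 / s)) ^ t := by gcongr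
      _ = _ := by rw [← ENNReal.rpow_mul]; congr 1; ring

theorem exists_const_lintegral_le_of_mixed_lintegral_ne_top {α H ι : Type*} [MeasurableSpace α]
    [NormedAddCommGroup H] [InnerProductSpace ℂ H] [CompleteSpace H] [Fintype ι]
    (b₀ : Module.Basis ι ℂ H) {ν : Measure α} [IsProbabilityMeasure ν]
    {s t : ℝ} (hs : 1 < s) (ht : 0 < t) {U V : α → H →L[ℂ] H} (hVm : AEStronglyMeasurable V ν)
    (hU : ∀ᵐ x ∂ν, star (U x) = U x) (hV : ∀ᵐ x ∂ν, star (V x) = V x)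
    (hUV : ∀ᵐ x ∂ν, U x * V x = 1)
    (hA : ∫⁻ z, (∫⁻ y, ‖U z * V y‖ₑ ^ s ∂ν) ^ (t / s) ∂ν ≠ ⊤) {R : ℝ≥0∞}
    (hR : ∀ e, ∀ᵐ x ∂ν, ‖U x e‖ₑ ^ t ≤ R * ∫⁻ z, ‖U z e‖ₑ ^ t ∂ν) :
    ∀ᵐ x ∂ν, ∫⁻ y, ‖U x * V y‖ₑ ^ s ∂ν ≤
      (Fintype.card ι : ℝ≥0∞) ^ (s - 1) * Fintype.card ι *
        ((∫⁻ z, (∫⁻ y, ‖U z * V y‖ₑ ^ s ∂ν) ^ (t / s) ∂ν) * R) ^ (s / t) := by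
  have hs0 : 0 < s := by linarith
  obtain ⟨b, q, hq, hb, hqA⟩ :=
    exists_dual_basis_of_mixed_lintegral_ne_top b₀ hs ht hVm hU hV hUV hA
  set A := ∫⁻ z, (∫⁻ y, ‖U z * V y‖ₑ ^ s ∂ν) ^ (t / s) ∂ν
  have hVem : ∀ e, AEMeasurable (fun y => ‖V y e‖ₑ) ν := fun e =>
    ((ContinuousLinearMap.apply ℂ H e).continuous.comp_aestronglyMeasurable hVm).enorm
  filter_upwards [hU, ae_all_iff.2 fun i => hR (q i)] with x hx hxq
  have hxq' : ∀ i, ‖U x (q i)‖ₑ ≤ (A * R) ^ (1 / t) := fun i => by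
    rw [one_div, ENNReal.le_rpow_inv_iff ht]
    refine (hxq i).trans ?_
    rw [mul_comm]
    gcongr
    exact hqA i
  have hpt : ∀ᵐ y ∂ν, ‖U x * V y‖ₑ ^ s ≤ (Fintype.card ι : ℝ≥0∞) ^ (s - 1) *
      ∑ i, (A * R) ^ (s / t) * ‖V y (b i)‖ₑ ^ s := by
    filter_upwards [hV] with y hy
    have h1 : ‖V y * U x‖ ≤ ∑ i, ‖U x (q i)‖ * ‖V y (b i)‖ := by
      refine ContinuousLinearMap.opNorm_le_bound _ (by positivity) fun f => ?_
      have h2 : (V y * U x) f = ∑ i, b.coord i (U x f) • V y (b i) := by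
        rw [mul_apply_eq_comp]
        conv_lhs => rw [← b.sum_repr (U x f)]
        simp only [map_sum, map_smul, Module.Basis.coord_apply]
      rw [h2, Finset.sum_mul]
      refine (norm_sum_le _ _).trans (Finset.sum_le_sum fun i _ => ?_)
      rw [norm_smul, hq, ← ContinuousLinearMap.adjoint_inner_left,
        ← ContinuousLinearMap.star_eq_adjoint, hx]
      calc _ ≤ (‖U x (q i)‖ * ‖f‖) * ‖V y (b i)‖ := by gcongr; exact norm_inner_le_norm _ _
        _ = _ := by ring
    have h3 : ‖U x * V y‖ₑ ≤ ∑ i, (A * R) ^ (1 / t) * ‖V y (b i)‖ₑ := by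
      rw [enorm_mul_comm_of_adjoint_eq hx hy, ← ofReal_norm]
      refine (ENNReal.ofReal_le_ofReal h1).trans ?_
      rw [ENNReal.ofReal_sum_of_nonneg fun i _ => by positivity]
      refine Finset.sum_le_sum fun i _ => ?_
      rw [ENNReal.ofReal_mul (norm_nonneg _), ofReal_norm, ofReal_norm]
      gcongr
      exact hxq' i
    refine (ENNReal.rpow_le_rpow h3 hs0.le).trans
      ((ENNReal.rpow_sum_le_const_mul_sum_rpow _ _ hs.le).trans (le_of_eq ?_))
    congr 1
    refine Finset.sum_congr rfl fun i _ => ?_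
    rw [ENNReal.mul_rpow_of_nonneg _ _ hs0.le, ← ENNReal.rpow_mul]
    congr 2
    ring
  refine (lintegral_mono_ae hpt).trans ?_
  have hm : ∀ i, AEMeasurable (fun y => (A * R) ^ (s / t) * ‖V y (b i)‖ₑ ^ s) ν := fun i =>
    ((hVem (b i)).pow_const s).const_mul _
  rw [lintegral_const_mul'' _ (Finset.aemeasurable_fun_sum _ fun i _ => hm i),
    lintegral_finsetSum' _ fun i _ => hm i, mul_assoc]
  gcongr
  calc ∑ i, ∫⁻ y, (A * R) ^ (s / t) * ‖V y (b i)‖ₑ ^ s ∂ν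
      ≤ ∑ _i : ι, (A * R) ^ (s / t) := Finset.sum_le_sum fun i _ => by
        rw [lintegral_const_mul'' _ ((hVem (b i)).pow_const s)]
        exact mul_le_of_le_one_right' (hb i)
    _ = _ := by simp

theorem ae_enorm_rpow_le_essSup_mul_lintegral {α H : Type*} [MeasurableSpace α]
    [NormedAddCommGroup H] [InnerProductSpace ℂ H]
    {ν : Measure α} [IsProbabilityMeasure ν]
    {s t : ℝ} (hst : s.HolderConjugate t) {U V : α → H →L[ℂ] H}
    (hUm : AEStronglyMeasurable U ν) (hVm : AEStronglyMeasurable V ν)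
    (hVU : ∀ᵐ x ∂ν, V x * U x = 1) (e : H) :
    ∀ᵐ x ∂ν, ‖U x e‖ₑ ^ t ≤ essSup (fun x => ∫⁻ y, ‖U x * V y‖ₑ ^ s ∂ν) ν ^ (t / s) *
      ∫⁻ z, ‖U z e‖ₑ ^ t ∂ν := by
  have ht0 : 0 < t := hst.symm.pos
  filter_upwards [ae_le_essSup (μ := ν) fun x => ∫⁻ y, ‖U x * V y‖ₑ ^ s ∂ν] with x hx
  have h1 : ‖U x e‖ₑ ≤ ∫⁻ y, ‖U x * V y‖ₑ * ‖U y e‖ₑ ∂ν := by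
    calc ‖U x e‖ₑ = ∫⁻ _, ‖U x e‖ₑ ∂ν := by simp
      _ ≤ _ := lintegral_mono_ae <| by
        filter_upwards [hVU] with y hy
        have h2 : (U x * V y) (U y e) = U x e := by
          rw [← mul_apply_eq_comp, mul_assoc, hy, mul_one]
        rw [← h2]
        exact ContinuousLinearMap.le_opENorm _ _
  have h2 := ENNReal.lintegral_mul_le_Lp_mul_Lq ν hst (f := fun y => ‖U x * V y‖ₑ)
    (g := fun y => ‖U y e‖ₑ) ((continuous_const_mul (U x)).comp_aestronglyMeasurable hVm).enorm
    ((ContinuousLinearMap.apply ℂ H e).continuous.comp_aestronglyMeasurable hUm).enorm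
  calc ‖U x e‖ₑ ^ t ≤ ((∫⁻ y, ‖U x * V y‖ₑ ^ s ∂ν) ^ (1 / s) *
        (∫⁻ y, ‖U y e‖ₑ ^ t ∂ν) ^ (1 / t)) ^ t := by
        gcongr
        exact h1.trans h2
    _ = (∫⁻ y, ‖U x * V y‖ₑ ^ s ∂ν) ^ (t / s) * ∫⁻ y, ‖U y e‖ₑ ^ t ∂ν := by
        rw [ENNReal.mul_rpow_of_nonneg _ _ ht0.le, ← ENNReal.rpow_mul, ← ENNReal.rpow_mul,
          one_div_mul_cancel ht0.ne', ENNReal.rpow_one, one_div_mul_eq_div]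
    _ ≤ _ := by
        have := hst.pos
        gcongr

section MatrixPowers

open scoped Matrix.Norms.L2Operator

variable {d : ℕ} {A : Matrix (Fin d) (Fin d) ℂ}

theorem Matrix.PosDef.pos_of_mem_spectrum_real (hA : A.PosDef) {x : ℝ} (hx : x ∈ spectrum ℝ A) :
    0 < x := by
  rw [hA.isHermitian.spectrum_real_eq_range_eigenvalues] at hx
  obtain ⟨i, rfl⟩ := hx
  exact hA.eigenvalues_pos i

theorem Matrix.PosDef.continuousOn_rpow_spectrum (hA : A.PosDef) (a : ℝ) :
    ContinuousOn (fun x : ℝ => x ^ a) (spectrum ℝ A) := fun x hx =>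
  (Real.continuousAt_rpow_const x a
    (Or.inl (hA.pos_of_mem_spectrum_real hx).ne')).continuousWithinAt

theorem star_matRpow (A : Matrix (Fin d) (Fin d) ℂ) (a : ℝ) : star (matRpow A a) = matRpow A a :=
  cfc_predicate (R := ℝ) (fun x : ℝ => x ^ a) A

theorem matRpow_mul_matRpow_neg (hA : A.PosDef) (a : ℝ) :
    matRpow A a * matRpow A (-a) = 1 := by
  have hsa : IsSelfAdjoint A := hA.isHermitian
  rw [matRpow, matRpow, ← cfc_mul _ _ A (hA.continuousOn_rpow_spectrum a)
    (hA.continuousOn_rpow_spectrum (-a)), ← cfc_const_one ℝ A]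
  refine cfc_congr fun x hx => ?_
  have := hA.pos_of_mem_spectrum_real hx
  simp only [Real.rpow_neg this.le]
  exact mul_inv_cancel₀ (Real.rpow_pos_of_pos this a).ne'

theorem matRpow_matRpow (hA : A.PosDef) (a b : ℝ) :
    matRpow (matRpow A a) b = matRpow A (a * b) := by
  have hsa : IsSelfAdjoint A := hA.isHermitian
  rw [matRpow, matRpow, matRpow, ← cfc_comp' (fun x : ℝ => x ^ b) (fun x : ℝ => x ^ a) A _
    (hA.continuousOn_rpow_spectrum a)]
  · refine cfc_congr fun x hx => ?_
    exact (Real.rpow_mul (hA.pos_of_mem_spectrum_real hx).le a b).symm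
  · rintro _ ⟨x, hx, rfl⟩
    exact (Real.continuousAt_rpow_const _ b (Or.inl
      (Real.rpow_pos_of_pos (hA.pos_of_mem_spectrum_real hx) a).ne')).continuousWithinAt

theorem norm_matRpow_le (hA : A.PosDef) {a : ℝ} (ha : 0 ≤ a) : ‖matRpow A a‖ ≤ ‖A‖ ^ a := by
  refine norm_cfc_le (by positivity) fun x hx => ?_
  have hx0 := hA.pos_of_mem_spectrum_real hx
  rw [Real.norm_of_nonneg (by positivity)]
  rcases isEmpty_or_nonempty (Fin d) with h | h
  · exact absurd hx (by simp [spectrum.of_subsingleton])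
  gcongr
  exact (le_abs_self x).trans (spectrum.norm_le_norm_of_mem hx)

theorem continuous_matRpow_hermitianPart {a : ℝ} (ha : 0 ≤ a) :
    Continuous fun A : Matrix (Fin d) (Fin d) ℂ => matRpow ((2⁻¹ : ℝ) • (A + star A)) a := by
  rcases isEmpty_or_nonempty (Fin d) with h | h
  · exact continuous_of_const fun _ _ => Subsingleton.elim _ _
  have hc : Continuous fun A : Matrix (Fin d) (Fin d) ℂ => (2⁻¹ : ℝ) • (A + star A) := by fun_prop
  refine Continuous.cfc
    (s := fun A => Metric.closedBall (0 : ℝ) (‖(2⁻¹ : ℝ) • (A + star A)‖ + 1)) _ hc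
    (fun _ => isCompact_closedBall _ _) (fun A => ?_)
    (fun A => (Real.continuous_rpow_const ha).continuousOn)
    (fun A => (IsSelfAdjoint.all _).smul (IsSelfAdjoint.add_star_self A))
  filter_upwards [hc.norm.continuousAt.eventually_lt continuousAt_const
    (lt_add_one ‖(2⁻¹ : ℝ) • (A + star A)‖)] with B hB x hx
  rw [mem_closedBall_zero_iff]
  exact (spectrum.norm_le_norm_of_mem hx).trans hB.le

end MatrixPowers

section MatrixWeights

variable {α : Type*} {d : ℕ}

open Matrix in
/-- The operator-valued function `x ↦ W(x)^a`. -/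
def opPow (W : α → Matrix (Fin d) (Fin d) ℂ) (a : ℝ) (x : α) :
    EuclideanSpace ℂ (Fin d) →L[ℂ] EuclideanSpace ℂ (Fin d) :=
  toEuclideanCLM (𝕜 := ℂ) (matRpow (W x) a)

theorem continuous_toEuclideanCLM :
    Continuous (Matrix.toEuclideanCLM (n := Fin d) (𝕜 := ℂ)) :=
  LinearMap.continuous_of_finiteDimensional
    (Matrix.toEuclideanCLM (n := Fin d) (𝕜 := ℂ)).toAlgEquiv.toLinearMap

theorem star_opPow (W : α → Matrix (Fin d) (Fin d) ℂ) (a : ℝ) (x : α) :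
    star (opPow W a x) = opPow W a x := by
  rw [opPow, ← map_star, star_matRpow]

theorem opPow_mul_opPow_neg {W : α → Matrix (Fin d) (Fin d) ℂ} {x : α} (hx : (W x).PosDef)
    (a : ℝ) : opPow W a x * opPow W (-a) x = 1 := by
  rw [opPow, opPow, ← map_mul, matRpow_mul_matRpow_neg hx, map_one]

theorem opPow_neg_mul_opPow {W : α → Matrix (Fin d) (Fin d) ℂ} {x : α} (hx : (W x).PosDef)
    (a : ℝ) : opPow W (-a) x * opPow W a x = 1 := by
  simpa using opPow_mul_opPow_neg hx (-a)

open scoped Matrix.Norms.L2Operator in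
theorem enorm_opPow_apply_rpow_le {W : α → Matrix (Fin d) (Fin d) ℂ} {x : α}
    (hx : (W x).PosDef) {t : ℝ} (ht : 0 < t) (e : EuclideanSpace ℂ (Fin d)) :
    ‖opPow W (1 / t) x e‖ₑ ^ t ≤ ‖W x‖ₑ * ‖e‖ₑ ^ t := by
  have h : ‖opPow W (1 / t) x‖ ≤ ‖W x‖ ^ (1 / t) := norm_matRpow_le hx (by positivity)
  have h2 : ‖opPow W (1 / t) x‖ₑ ≤ ‖W x‖ₑ ^ (1 / t) := by
    rw [← ofReal_norm, ← ofReal_norm, ENNReal.ofReal_rpow_of_nonneg (norm_nonneg _) (by positivity)]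
    exact ENNReal.ofReal_le_ofReal h
  calc ‖opPow W (1 / t) x e‖ₑ ^ t ≤ (‖W x‖ₑ ^ (1 / t) * ‖e‖ₑ) ^ t := by
        gcongr
        exact ((opPow W (1 / t) x).le_opENorm e).trans (by gcongr)
    _ = _ := by
        rw [ENNReal.mul_rpow_of_nonneg _ _ ht.le, ← ENNReal.rpow_mul, one_div_mul_cancel ht.ne',
          ENNReal.rpow_one]

variable [MeasurableSpace α]

theorem aestronglyMeasurable_matRpow {μ : Measure α} {W : α → Matrix (Fin d) (Fin d) ℂ}
    (hW : AEStronglyMeasurable W μ) (hpos : ∀ᵐ x ∂μ, (W x).PosDef) {a : ℝ} (ha : 0 ≤ a) :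
    AEStronglyMeasurable (fun x => matRpow (W x) a) μ := by
  refine ((continuous_matRpow_hermitianPart ha).comp_aestronglyMeasurable hW).congr ?_
  filter_upwards [hpos] with x hx
  have : star (W x) = W x := hx.isHermitian
  simp only [this, ← two_smul ℝ (W x), smul_smul]
  norm_num

theorem aestronglyMeasurable_matRpow_neg {μ : Measure α} {W : α → Matrix (Fin d) (Fin d) ℂ}
    (hW : AEStronglyMeasurable W μ) (hpos : ∀ᵐ x ∂μ, (W x).PosDef) {a : ℝ} (ha : 0 ≤ a) :
    AEStronglyMeasurable (fun x => matRpow (W x) (-a)) μ := by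
  have hU := aestronglyMeasurable_matRpow hW hpos ha
  have h1 : AEStronglyMeasurable (fun x => (matRpow (W x) a).det) μ :=
    (Continuous.matrix_det continuous_id).comp_aestronglyMeasurable hU
  have h2 : AEStronglyMeasurable (fun x => (matRpow (W x) a).adjugate) μ :=
    (Continuous.matrix_adjugate continuous_id).comp_aestronglyMeasurable hU
  refine (h1.inv₀.smul h2).congr ?_
  filter_upwards [hpos] with x hx
  have h3 := matRpow_mul_matRpow_neg hx a
  rw [← Matrix.inv_eq_right_inv h3, Matrix.inv_def, Ring.inverse_eq_inv']
  rfl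

open scoped Matrix.Norms.L2Operator in
theorem integrable_of_entries {μ : Measure α} {W : α → Matrix (Fin d) (Fin d) ℂ}
    (hW : ∀ i j, Integrable (fun x => W x i j) μ) : Integrable W μ := by
  have h : W = fun x => ∑ i, ∑ j, (W x i j) • Matrix.single i j (1 : ℂ) := by
    ext1 x
    conv_lhs => rw [Matrix.matrix_eq_sum_single (W x)]
    simp
  rw [h]
  exact integrable_finsetSum _ fun i _ => integrable_finsetSum _ fun j _ =>
    (hW i j).smul_const _

open scoped Matrix.Norms.L2Operator in
theorem lintegral_enorm_opPow_apply_ne_top {ν : Measure α} {W : α → Matrix (Fin d) (Fin d) ℂ}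
    (hW : ∀ i j, Integrable (fun x => W x i j) ν) (hpos : ∀ᵐ x ∂ν, (W x).PosDef)
    {t : ℝ} (ht : 0 < t) (e : EuclideanSpace ℂ (Fin d)) :
    ∫⁻ x, ‖opPow W (1 / t) x e‖ₑ ^ t ∂ν ≠ ⊤ := by
  refine ne_top_of_le_ne_top ?_ (lintegral_mono_ae
    (hpos.mono fun x hx => enorm_opPow_apply_rpow_le hx ht e))
  rw [lintegral_mul_const' _ _ (by finiteness)]
  exact ENNReal.mul_ne_top (integrable_of_entries hW).2.ne (by finiteness)

theorem aestronglyMeasurable_opPow {ν : Measure α} {W : α → Matrix (Fin d) (Fin d) ℂ}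
    (hW : AEStronglyMeasurable W ν) (hpos : ∀ᵐ x ∂ν, (W x).PosDef) {a : ℝ} (ha : 0 ≤ a) :
    AEStronglyMeasurable (opPow W a) ν :=
  continuous_toEuclideanCLM.comp_aestronglyMeasurable (aestronglyMeasurable_matRpow hW hpos ha)

theorem aestronglyMeasurable_opPow_neg {ν : Measure α} {W : α → Matrix (Fin d) (Fin d) ℂ}
    (hW : AEStronglyMeasurable W ν) (hpos : ∀ᵐ x ∂ν, (W x).PosDef) {a : ℝ} (ha : 0 ≤ a) :
    AEStronglyMeasurable (opPow W (-a)) ν :=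
  continuous_toEuclideanCLM.comp_aestronglyMeasurable
    (aestronglyMeasurable_matRpow_neg hW hpos ha)

theorem lintegral_enorm_opPow_apply_ne_zero {ν : Measure α} [IsProbabilityMeasure ν]
    {W : α → Matrix (Fin d) (Fin d) ℂ}
    (hW : AEStronglyMeasurable W ν) (hpos : ∀ᵐ x ∂ν, (W x).PosDef)
    {t : ℝ} (ht : 0 < t) {e : EuclideanSpace ℂ (Fin d)} (he : e ≠ 0) :
    ∫⁻ x, ‖opPow W (1 / t) x e‖ₑ ^ t ∂ν ≠ 0 := by
  have hU : AEStronglyMeasurable (opPow W (1 / t)) ν :=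
    aestronglyMeasurable_opPow hW hpos (by positivity)
  have hUe : AEStronglyMeasurable (fun x => opPow W (1 / t) x e) ν :=
    (ContinuousLinearMap.apply ℂ (EuclideanSpace ℂ (Fin d)) e).continuous.comp_aestronglyMeasurable
      hU
  rw [Ne, lintegral_eq_zero_iff' (hUe.enorm.pow_const t)]
  intro h
  obtain ⟨x, hx, hx0⟩ := (hpos.and h).exists
  have h0 : opPow W (1 / t) x e = 0 := by
    simpa [ENNReal.rpow_eq_zero_iff, ht, ht.le, ht.not_gt] using hx0
  apply he
  have h1 : (opPow W (-(1 / t)) x * opPow W (1 / t) x) e = e := by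
    rw [opPow_neg_mul_opPow hx, one_apply_eq_self]
  rw [← h1, mul_apply_eq_comp, h0, map_zero]

open ProbabilityTheory

theorem lavg_eq_lintegral_cond (μ : Measure α) (Q : Set α) (f : α → ℝ≥0∞) :
    lavg μ Q f = ∫⁻ x, f x ∂μ[|Q] := by
  rw [lavg, ProbabilityTheory.cond, lintegral_smul_measure, smul_eq_mul]

theorem ofReal_specNorm_mul (A B : Matrix (Fin d) (Fin d) ℂ) :
    ENNReal.ofReal (specNorm (A * B)) =
      ‖Matrix.toEuclideanCLM (𝕜 := ℂ) A * Matrix.toEuclideanCLM (𝕜 := ℂ) B‖ₑ := by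
  rw [specNorm, map_mul, ofReal_norm]

theorem matApq_eq_iSup_lintegral_cond (μ : Measure α) (S : Set (Set α))
    (W : α → Matrix (Fin d) (Fin d) ℂ) (t : ℝ) :
    matApq μ S W t t = ⨆ Q ∈ S, ∫⁻ z, (∫⁻ y, ‖opPow W (1 / t) z * opPow W (-(1 / t)) y‖ₑ
      ^ conjExp t ∂μ[|Q]) ^ (t / conjExp t) ∂μ[|Q] := by
  simp only [matApq, lavg_eq_lintegral_cond, ofReal_specNorm_mul, opPow]

theorem matRHInfty_eq_iSup_essSup_cond {μ : Measure α} {S : Set (Set α)}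
    (hS : ∀ Q ∈ S, μ Q ≠ ⊤) (W : α → Matrix (Fin d) (Fin d) ℂ) {t : ℝ} (ht : 0 ≤ t) :
    matRHInfty μ S W t = ⨆ (e : EuclideanSpace ℂ (Fin d)) (_ : e ≠ 0), ⨆ Q ∈ S,
      essSup (fun x => ‖opPow W (1 / t) x e‖ₑ ^ t) μ[|Q] /
        ∫⁻ x, ‖opPow W (1 / t) x e‖ₑ ^ t ∂μ[|Q] := by
  simp only [matRHInfty, scalRHInfty, lavg_eq_lintegral_cond, opPow,
    ← ENNReal.ofReal_rpow_of_nonneg (norm_nonneg _) ht, ofReal_norm]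
  refine iSup_congr fun e => iSup_congr fun _ => iSup_congr fun Q => iSup_congr fun hQ => ?_
  rw [ProbabilityTheory.cond, essSup_ennreal_smul_measure (ENNReal.inv_ne_zero.2 (hS Q hQ))]

theorem matAtInfty_eq_iSup_essSup_cond {μ : Measure α} {S : Set (Set α)}
    (hS : ∀ Q ∈ S, μ Q ≠ ⊤) {W : α → Matrix (Fin d) (Fin d) ℂ}
    (hpos : ∀ᵐ x ∂μ, (W x).PosDef) {s : ℝ} (hs : s ≠ 0) (t : ℝ) :
    matAtInfty μ S (fun x => matRpow (W x) (s / t)) s = ⨆ Q ∈ S,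
      essSup (fun x => ∫⁻ y, ‖opPow W (1 / t) x * opPow W (-(1 / t)) y‖ₑ ^ s ∂μ[|Q]) μ[|Q] := by
  simp only [matAtInfty, lavg_eq_lintegral_cond, ofReal_specNorm_mul]
  refine iSup_congr fun Q => iSup_congr fun hQ => ?_
  rw [← essSup_ennreal_smul_measure (ENNReal.inv_ne_zero.2 (hS Q hQ)), ← ProbabilityTheory.cond]
  have hposQ : ∀ᵐ x ∂μ[|Q], (W x).PosDef := ProbabilityTheory.cond_absolutelyContinuous.ae_le hpos
  refine essSup_congr_ae ?_
  filter_upwards [hposQ] with x hx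
  refine lintegral_congr_ae ?_
  filter_upwards [hposQ] with y hy
  have h1 : s / t * (1 / s) = 1 / t := by field_simp
  have h2 : s / t * -(1 / s) = -(1 / t) := by rw [mul_neg, h1]
  rw [matRpow_matRpow hx, matRpow_matRpow hy, h1, h2]
  rfl

variable {μ : Measure α} {S : Set (Set α)} {W : α → Matrix (Fin d) (Fin d) ℂ} {t : ℝ}

theorem holderConjugate_conjExp (ht : 1 < t) : (conjExp t).HolderConjugate t :=
  ((Real.holderConjugate_iff_eq_conjExponent ht).2 rfl).symm

theorem max_matApq_matRHInfty_rpow_le (ht : 1 < t) (hS : ∀ Q ∈ S, μ Q ≠ 0 ∧ μ Q ≠ ⊤)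
    (hW : ∀ Q ∈ S, ∀ i j, IntegrableOn (fun x => W x i j) Q μ)
    (hpos : ∀ᵐ x ∂μ, (W x).PosDef) :
    max (matApq μ S W t t) (matRHInfty μ S W t) ^ (conjExp t / t) ≤
      matAtInfty μ S (fun x => matRpow (W x) (conjExp t / t)) (conjExp t) := by
  have hst := holderConjugate_conjExp ht
  have hs0 := hst.pos
  have ht0 : 0 < t := by linarith
  have hS' : ∀ Q ∈ S, μ Q ≠ ⊤ := fun Q hQ => (hS Q hQ).2
  set B := matAtInfty μ S (fun x => matRpow (W x) (conjExp t / t)) (conjExp t) with hB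
  rw [matAtInfty_eq_iSup_essSup_cond hS' hpos hs0.ne' t] at hB
  have hBQ : ∀ Q ∈ S, essSup (fun x => ∫⁻ y, ‖opPow W (1 / t) x * opPow W (-(1 / t)) y‖ₑ
      ^ conjExp t ∂μ[|Q]) μ[|Q] ≤ B := fun Q hQ => by
    rw [hB]
    exact le_iSup₂_of_le Q hQ le_rfl
  suffices h : max (matApq μ S W t t) (matRHInfty μ S W t) ≤ B ^ (t / conjExp t) by
    refine (ENNReal.rpow_le_rpow h (by positivity)).trans (le_of_eq ?_)
    rw [← ENNReal.rpow_mul, div_mul_div_cancel₀ hs0.ne', div_self ht0.ne', ENNReal.rpow_one]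
  rw [max_le_iff, matApq_eq_iSup_lintegral_cond, matRHInfty_eq_iSup_essSup_cond hS' W ht0.le]
  refine ⟨iSup₂_le fun Q hQ => ?_, iSup₂_le fun e he => iSup₂_le fun Q hQ => ?_⟩
  · have : IsProbabilityMeasure μ[|Q] := cond_isProbabilityMeasure_of_finite (hS Q hQ).1 (hS' Q hQ)
    calc _ ≤ ∫⁻ _, B ^ (t / conjExp t) ∂μ[|Q] := by
          refine lintegral_mono_ae ?_
          filter_upwards [ae_le_essSup (μ := μ[|Q]) fun x => ∫⁻ y, ‖opPow W (1 / t) x *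
            opPow W (-(1 / t)) y‖ₑ ^ conjExp t ∂μ[|Q]] with x hx
          gcongr
          exact hx.trans (hBQ Q hQ)
      _ = _ := by simp
  · have : IsProbabilityMeasure μ[|Q] := cond_isProbabilityMeasure_of_finite (hS Q hQ).1 (hS' Q hQ)
    have hposQ : ∀ᵐ x ∂μ[|Q], (W x).PosDef :=
      ProbabilityTheory.cond_absolutelyContinuous.ae_le hpos
    have hWm : AEStronglyMeasurable W μ[|Q] :=
      (integrable_of_entries (hW Q hQ)).1.smul_measure _
    refine ENNReal.div_le_of_le_mul (essSup_le_of_ae_le _ ?_)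
    filter_upwards [ae_enorm_rpow_le_essSup_mul_lintegral hst
      (aestronglyMeasurable_opPow hWm hposQ (a := 1 / t) (by positivity))
      (aestronglyMeasurable_opPow_neg hWm hposQ (a := 1 / t) (by positivity))
      (hposQ.mono fun x hx => opPow_neg_mul_opPow hx _) e] with x hx
    refine hx.trans ?_
    gcongr
    exact hBQ Q hQ

theorem ae_enorm_opPow_apply_rpow_le (ht : 0 < t) (hS : ∀ Q ∈ S, μ Q ≠ 0 ∧ μ Q ≠ ⊤)
    (hW : ∀ Q ∈ S, ∀ i j, IntegrableOn (fun x => W x i j) Q μ)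
    (hpos : ∀ᵐ x ∂μ, (W x).PosDef) {Q : Set α} (hQ : Q ∈ S) (e : EuclideanSpace ℂ (Fin d)) :
    ∀ᵐ x ∂μ[|Q], ‖opPow W (1 / t) x e‖ₑ ^ t ≤
      matRHInfty μ S W t * ∫⁻ z, ‖opPow W (1 / t) z e‖ₑ ^ t ∂μ[|Q] := by
  rcases eq_or_ne e 0 with rfl | he
  · simp [ht]
  have : IsProbabilityMeasure μ[|Q] := cond_isProbabilityMeasure_of_finite (hS Q hQ).1 (hS Q hQ).2
  have hposQ : ∀ᵐ x ∂μ[|Q], (W x).PosDef :=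
    ProbabilityTheory.cond_absolutelyContinuous.ae_le hpos
  have hWi : ∀ i j, Integrable (fun x => W x i j) μ[|Q] := fun i j =>
    (hW Q hQ i j).smul_measure (ENNReal.inv_ne_top.2 (hS Q hQ).1)
  have h0 := lintegral_enorm_opPow_apply_ne_zero (integrable_of_entries hWi).1 hposQ ht he
  have h1 := lintegral_enorm_opPow_apply_ne_top hWi hposQ ht e
  have h2 : essSup (fun x => ‖opPow W (1 / t) x e‖ₑ ^ t) μ[|Q] ≤
      matRHInfty μ S W t * ∫⁻ z, ‖opPow W (1 / t) z e‖ₑ ^ t ∂μ[|Q] := by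
    rw [← ENNReal.div_le_iff h0 h1, matRHInfty_eq_iSup_essSup_cond (fun Q hQ => (hS Q hQ).2) W ht.le]
    exact le_iSup₂_of_le e he (le_iSup₂_of_le Q hQ le_rfl)
  filter_upwards [ae_le_essSup (μ := μ[|Q]) fun x => ‖opPow W (1 / t) x e‖ₑ ^ t] with x hx
    using hx.trans h2

theorem matRHInfty_ne_zero [NeZero d] (hne : S.Nonempty) (ht : 0 < t)
    (hS : ∀ Q ∈ S, μ Q ≠ 0 ∧ μ Q ≠ ⊤)
    (hW : ∀ Q ∈ S, ∀ i j, IntegrableOn (fun x => W x i j) Q μ)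
    (hpos : ∀ᵐ x ∂μ, (W x).PosDef) : matRHInfty μ S W t ≠ 0 := by
  intro hR
  obtain ⟨Q, hQ⟩ := hne
  obtain ⟨e, he⟩ := exists_ne (0 : EuclideanSpace ℂ (Fin d))
  have : IsProbabilityMeasure μ[|Q] := cond_isProbabilityMeasure_of_finite (hS Q hQ).1 (hS Q hQ).2
  have hposQ : ∀ᵐ x ∂μ[|Q], (W x).PosDef :=
    ProbabilityTheory.cond_absolutelyContinuous.ae_le hpos
  have hWm : AEStronglyMeasurable W μ[|Q] := (integrable_of_entries (hW Q hQ)).1.smul_measure _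
  refine lintegral_enorm_opPow_apply_ne_zero hWm hposQ ht he (le_antisymm ?_ zero_le)
  refine (lintegral_mono_ae (ae_enorm_opPow_apply_rpow_le ht hS hW hpos hQ e)).trans ?_
  simp [hR]

theorem matAtInfty_le_mul_matApq_mul_matRHInfty_rpow (hne : S.Nonempty) (ht : 1 < t)
    (hS : ∀ Q ∈ S, μ Q ≠ 0 ∧ μ Q ≠ ⊤)
    (hW : ∀ Q ∈ S, ∀ i j, IntegrableOn (fun x => W x i j) Q μ)
    (hpos : ∀ᵐ x ∂μ, (W x).PosDef) :
    matAtInfty μ S (fun x => matRpow (W x) (conjExp t / t)) (conjExp t) ≤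
      ((d : ℝ≥0∞) ^ (conjExp t - 1) * d + 1) *
        (matApq μ S W t t * matRHInfty μ S W t) ^ (conjExp t / t) := by
  have hst := holderConjugate_conjExp ht
  have hs0 := hst.pos
  have ht0 : 0 < t := by linarith
  have hS' : ∀ Q ∈ S, μ Q ≠ ⊤ := fun Q hQ => (hS Q hQ).2
  rw [matAtInfty_eq_iSup_essSup_cond hS' hpos hs0.ne' t]
  rcases Nat.eq_zero_or_pos d with rfl | hd
  · have h : ∀ x y, ‖opPow W (1 / t) x * opPow W (-(1 / t)) y‖ₑ = 0 := fun x y => by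
      rw [← ofReal_norm, Subsingleton.elim (opPow W (1 / t) x) 0, zero_mul, norm_zero,
        ENNReal.ofReal_zero]
    simp only [h, ENNReal.zero_rpow_of_pos hs0, lintegral_zero]
    exact iSup₂_le fun Q hQ => essSup_le_of_ae_le _ (.of_forall fun _ => zero_le)
  have : NeZero d := ⟨hd.ne'⟩
  rcases eq_or_ne (matApq μ S W t t) ⊤ with hA | hA
  · rw [hA, ENNReal.top_mul (matRHInfty_ne_zero hne ht0 hS hW hpos),
      ENNReal.top_rpow_of_pos (by positivity), ENNReal.mul_top (by simp)]
    exact le_top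
  refine iSup₂_le fun Q hQ => essSup_le_of_ae_le _ ?_
  have : IsProbabilityMeasure μ[|Q] := cond_isProbabilityMeasure_of_finite (hS Q hQ).1 (hS' Q hQ)
  have hposQ : ∀ᵐ x ∂μ[|Q], (W x).PosDef :=
    ProbabilityTheory.cond_absolutelyContinuous.ae_le hpos
  have hWm : AEStronglyMeasurable W μ[|Q] := (integrable_of_entries (hW Q hQ)).1.smul_measure _
  have hAQ : ∫⁻ z, (∫⁻ y, ‖opPow W (1 / t) z * opPow W (-(1 / t)) y‖ₑ
      ^ conjExp t ∂μ[|Q]) ^ (t / conjExp t) ∂μ[|Q] ≤ matApq μ S W t t := by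
    rw [matApq_eq_iSup_lintegral_cond]
    exact le_iSup₂_of_le Q hQ le_rfl
  filter_upwards [exists_const_lintegral_le_of_mixed_lintegral_ne_top
    (EuclideanSpace.basisFun (Fin d) ℂ).toBasis hst.lt ht0
    (aestronglyMeasurable_opPow_neg hWm hposQ (a := 1 / t) (by positivity))
    (.of_forall fun x => star_opPow W _ x) (.of_forall fun x => star_opPow W _ x)
    (hposQ.mono fun x hx => opPow_mul_opPow_neg hx _) (ne_top_of_le_ne_top hA hAQ)
    (ae_enorm_opPow_apply_rpow_le ht0 hS hW hpos hQ)] with x hx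
  refine hx.trans ?_
  rw [Fintype.card_fin]
  gcongr
  exact le_self_add

end MatrixWeights

theorem cube_eq_pi {n : ℕ} (c : Fin n → ℝ) (h : ℝ) :
    cube c h = Set.univ.pi fun i => Set.Ico (c i) (c i + h) := by
  ext x
  simp [cube]

theorem volume_cube {n : ℕ} (c : Fin n → ℝ) (h : ℝ) :
    volume (cube c h) = ENNReal.ofReal h ^ n := by
  rw [cube_eq_pi, Real.volume_pi_Ico]
  simp

theorem cube_subset_Icc {n : ℕ} (c : Fin n → ℝ) (h : ℝ) :
    cube c h ⊆ Set.Icc c (c + fun _ => h) := fun _ hx =>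
  ⟨fun i => (hx i).1, fun i => (hx i).2.le⟩

theorem cubes_nonempty (n : ℕ) : (cubes n).Nonempty :=
  ⟨cube 0 1, 0, 1, one_pos, rfl⟩

theorem statement1 (d : ℕ) (t : ℝ) (ht : 1 < t) :
    ∃ c₁ c₂ : ℝ≥0∞, 0 < c₁ ∧ c₁ < ⊤ ∧ 0 < c₂ ∧ c₂ < ⊤ ∧
      ∀ (n : ℕ) (W : (Fin n → ℝ) → Matrix (Fin d) (Fin d) ℂ),
        IsMatrixWeight (volume : Measure (Fin n → ℝ)) W →
          max (matApq volume (cubes n) W t t) (matRHInfty volume (cubes n) W t)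
                ^ (conjExp t / t)
              ≤ c₁ * matAtInfty volume (cubes n)
                  (fun x => matRpow (W x) (conjExp t / t)) (conjExp t) ∧
            matAtInfty volume (cubes n) (fun x => matRpow (W x) (conjExp t / t)) (conjExp t)
              ≤ c₂ * (matApq volume (cubes n) W t t * matRHInfty volume (cubes n) W t)
                  ^ (conjExp t / t) ∧
            ((matApq volume (cubes n) W t t < ⊤ ∧ matRHInfty volume (cubes n) W t < ⊤) ↔
              matAtInfty volume (cubes n) (fun x => matRpow (W x) (conjExp t / t)) (conjExp t)
                < ⊤) := by
  have hst := holderConjugate_conjExp ht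
  have hs0 := hst.pos
  have hc2 : (d : ℝ≥0∞) ^ (conjExp t - 1) * d + 1 < ⊤ :=
    ENNReal.add_lt_top.2 ⟨ENNReal.mul_lt_top
      (ENNReal.rpow_lt_top_of_nonneg (sub_nonneg.2 hst.lt.le) (ENNReal.natCast_ne_top d))
      (ENNReal.natCast_lt_top d), ENNReal.one_lt_top⟩
  refine ⟨1, (d : ℝ≥0∞) ^ (conjExp t - 1) * d + 1, one_pos, ENNReal.one_lt_top,
    by simp, hc2, fun n W hW => ?_⟩
  have hS : ∀ Q ∈ cubes n, volume Q ≠ 0 ∧ volume Q ≠ ⊤ := by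
    rintro _ ⟨c, h, hh, rfl⟩
    rw [volume_cube]
    exact ⟨pow_ne_zero _ (by simpa using hh), by finiteness⟩
  have hWi : ∀ Q ∈ cubes n, ∀ i j, IntegrableOn (fun x => W x i j) Q volume := by
    rintro _ ⟨c, h, hh, rfl⟩ i j
    exact ((hW.1 i j).integrableOn_isCompact isCompact_Icc).mono_set (cube_subset_Icc c h)
  have hlow := max_matApq_matRHInfty_rpow_le ht hS hWi hW.2
  have hup := matAtInfty_le_mul_matApq_mul_matRHInfty_rpow (cubes_nonempty n) ht hS hWi hW.2
  refine ⟨by rwa [one_mul], hup, fun h => ?_, fun h => ?_⟩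
  · exact hup.trans_lt (ENNReal.mul_lt_top hc2
      (ENNReal.rpow_lt_top_of_nonneg (by positivity) (ENNReal.mul_lt_top h.1 h.2).ne))
  · rw [← max_lt_iff]
    by_contra hcon
    rw [not_lt, top_le_iff] at hcon
    rw [hcon, ENNReal.top_rpow_of_pos (by positivity)] at hlow
    exact absurd h (not_lt.2 hlow)

end
end

section
/- Let W be a d×d matrix weight on ℝ^n and let 1 ≤ s ≤ t < ∞. Then [W]_{A_{t,∞}} ≤ [W]_{A_{s,∞}}. -/
open MeasureTheory ENNReal
open scoped ComplexOrder

noncomputable section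

section CStarAlgebra

open CFC

variable {A : Type*} [CStarAlgebra A] [PartialOrder A] [StarOrderedRing A]

lemma smul_rpow_of_isStrictlyPositive {c : ℝ} (hc : 0 < c) {a : A} (ha : IsStrictlyPositive a)
    (r : ℝ) : (c • a) ^ r = c ^ r • a ^ r := by
  have hpos : ∀ x ∈ spectrum ℝ a, 0 < x :=
    (StarOrderedRing.isStrictlyPositive_iff_spectrum_pos a ha.isSelfAdjoint).mp ha
  have hcont : ContinuousOn (fun x : ℝ => x ^ r) (spectrum ℝ a) := fun x hx =>
    (Real.continuousAt_rpow_const x r (Or.inl (hpos x hx).ne')).continuousWithinAt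
  have hsmul : c • a = cfc (fun x : ℝ => c * x) a := by
    rw [cfc_const_mul_id c a ha.isSelfAdjoint]
  rw [hsmul, cfc_rpow (fun x hx => mul_pos hc (hpos x hx)) (by fun_prop) ha.isSelfAdjoint,
    rpow_eq_cfc_real ha.nonneg, ← cfc_const_mul _ _ a hcont]
  exact cfc_congr fun x hx => Real.mul_rpow hc.le (hpos x hx).le

lemma rpow_two_mul {a : A} (ha : IsUnit a) (p : ℝ) : a ^ (2 * p) = a ^ p * a ^ p := by
  rw [two_mul, rpow_add ha]

lemma norm_sq_rpow_mul_rpow {a b : A} (ha : IsUnit a) (p q : ℝ) :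
    ‖a ^ p * b ^ q‖ ^ 2 = ‖b ^ q * a ^ (2 * p) * b ^ q‖ := by
  have hsa : ∀ (x : A) (y : ℝ), star (x ^ y) = x ^ y := fun x y =>
    (IsSelfAdjoint.of_nonneg rpow_nonneg).star_eq
  rw [sq, ← CStarRing.norm_star_mul_self, star_mul, hsa, hsa, rpow_two_mul ha]
  simp only [mul_assoc]

/-- `‖a ^ p * b ^ (-p)‖` is the least `c ≥ 0` with `a ^ (2p) ≤ c² b ^ (2p)`. -/
lemma norm_rpow_mul_rpow_neg_le_iff {a b : A} (ha : IsStrictlyPositive a)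
    (hb : IsStrictlyPositive b) (p : ℝ) {c : ℝ} (hc : 0 ≤ c) :
    ‖a ^ p * b ^ (-p)‖ ≤ c ↔ a ^ (2 * p) ≤ c ^ 2 • b ^ (2 * p) := by
  have hb₁ : b ^ p * b ^ (-p) = 1 := rpow_mul_rpow_neg p hb
  have hb₂ : b ^ (-p) * b ^ p = 1 := rpow_neg_mul_rpow p hb
  rw [← sq_le_sq₀ (norm_nonneg _) hc, norm_sq_rpow_mul_rpow ha.isUnit,
    CStarAlgebra.norm_le_iff_le_algebraMap _ (sq_nonneg c)
      (conjugate_nonneg_of_nonneg rpow_nonneg rpow_nonneg),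
    Algebra.algebraMap_eq_smul_one, rpow_two_mul hb.isUnit]
  constructor <;> intro h
  · convert! conjugate_le_conjugate_of_nonneg h (rpow_nonneg : 0 ≤ b ^ p) using 1
    · calc a ^ (2 * p) = (b ^ p * b ^ (-p)) * a ^ (2 * p) * (b ^ (-p) * b ^ p) := by simp [hb₁, hb₂]
        _ = _ := by simp only [mul_assoc]
    · simp
  · convert! conjugate_le_conjugate_of_nonneg h (rpow_nonneg : 0 ≤ b ^ (-p)) using 1
    calc c ^ 2 • (1 : A) = c ^ 2 • ((b ^ (-p) * b ^ p) * (b ^ p * b ^ (-p))) := by simp [hb₁, hb₂]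
      _ = _ := by simp only [mul_assoc, mul_smul_comm, smul_mul_assoc]

/-- **Cordes inequality** for strictly positive elements of a C⋆-algebra. -/
theorem norm_rpow_mul_rpow_neg_le {a b : A} (ha : IsStrictlyPositive a)
    (hb : IsStrictlyPositive b) {p r : ℝ} (hp : p ≠ 0) (hr : r ∈ Set.Icc (0 : ℝ) 1) :
    ‖a ^ (p * r) * b ^ (-(p * r))‖ ≤ ‖a ^ p * b ^ (-p)‖ ^ r := by
  obtain _ | _ := subsingleton_or_nontrivial A
  · rw [Subsingleton.elim (a ^ (p * r) * b ^ (-(p * r))) 0, norm_zero]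
    positivity
  set c := ‖a ^ p * b ^ (-p)‖
  have hc : 0 < c := norm_pos_iff.mpr
    ((ha.isUnit.cfcRpow p ha.nonneg).mul (hb.isUnit.cfcRpow (-p) hb.nonneg)).ne_zero
  have hp₂ : 2 * p ≠ 0 := mul_ne_zero two_ne_zero hp
  have hbp : IsStrictlyPositive (b ^ (2 * p)) :=
    (hb.isUnit.cfcRpow _ hb.nonneg).isStrictlyPositive rpow_nonneg
  have h := rpow_le_rpow hr ((norm_rpow_mul_rpow_neg_le_iff ha hb p hc.le).mp le_rfl)
  rw [smul_rpow_of_isStrictlyPositive (by positivity) hbp, rpow_rpow a _ _ hp₂ ha,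
    rpow_rpow b _ _ hp₂ hb, mul_assoc, ← Real.rpow_natCast_mul hc.le, mul_comm ((2 : ℕ) : ℝ),
    Real.rpow_mul_natCast hc.le] at h
  exact (norm_rpow_mul_rpow_neg_le_iff ha hb _ (by positivity)).mpr h

end CStarAlgebra

section Matrix

open scoped MatrixOrder Matrix.Norms.L2Operator

lemma specNorm_nonneg {d : ℕ} (A : Matrix (Fin d) (Fin d) ℂ) : 0 ≤ specNorm A :=
  norm_nonneg _

lemma matRpow_eq_rpow {d : ℕ} {A : Matrix (Fin d) (Fin d) ℂ} (hA : A.PosDef) (a : ℝ) :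
    matRpow A a = A ^ a :=
  (CFC.rpow_eq_cfc_real hA.posSemidef.nonneg).symm

lemma specNorm_matRpow_mul_rpow_le {d : ℕ} {A B : Matrix (Fin d) (Fin d) ℂ} (hA : A.PosDef)
    (hB : B.PosDef) {s t : ℝ} (hs : 0 < s) (hst : s ≤ t) :
    specNorm (matRpow A (1 / t) * matRpow B (-(1 / t))) ^ t ≤
      specNorm (matRpow A (1 / s) * matRpow B (-(1 / s))) ^ s := by
  have ht : 0 < t := hs.trans_le hst
  have h := norm_rpow_mul_rpow_neg_le (hA.isUnit.isStrictlyPositive hA.posSemidef.nonneg)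
    (hB.isUnit.isStrictlyPositive hB.posSemidef.nonneg) (one_div_ne_zero hs.ne')
    (⟨by positivity, div_le_one_of_le₀ hst ht.le⟩ : s / t ∈ Set.Icc (0 : ℝ) 1)
  rw [show 1 / s * (s / t) = 1 / t by field_simp] at h
  simp only [matRpow_eq_rpow hA, matRpow_eq_rpow hB, specNorm, ← Matrix.cstar_norm_def]
  calc _ ≤ _ := Real.rpow_le_rpow (norm_nonneg _) h ht.le
    _ = _ := by rw [← Real.rpow_mul (norm_nonneg _), div_mul_cancel₀ _ ht.ne']

end Matrix

theorem statement3 (d n : ℕ) (W : (Fin n → ℝ) → Matrix (Fin d) (Fin d) ℂ)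
    (hW : IsMatrixWeight (volume : Measure (Fin n → ℝ)) W)
    (s t : ℝ) (hs : 1 ≤ s) (hst : s ≤ t) :
    matAtInfty volume (cubes n) W t ≤ matAtInfty volume (cubes n) W s := by
  obtain ⟨-, hpos⟩ := hW
  have hs₀ : 0 < s := one_pos.trans_le hs
  refine iSup₂_mono fun Q _ => essSup_mono_ae ?_
  filter_upwards [ae_restrict_of_ae hpos] with x hx
  refine mul_le_mul_right (lintegral_mono_ae ?_) _
  filter_upwards [ae_restrict_of_ae hpos] with y hy
  rw [ENNReal.ofReal_rpow_of_nonneg (specNorm_nonneg _) (hs₀.le.trans hst),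
    ENNReal.ofReal_rpow_of_nonneg (specNorm_nonneg _) hs₀.le]
  exact ENNReal.ofReal_le_ofReal (specNorm_matRpow_mul_rpow_le hx hy hs₀ hst)

end
end
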